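/- Let p ∈ ℂ[z] be a polynomial of degree at least 2 without multiple roots. For f ∈ O(D_p), the map ν_f := {f, ·} : O(D_p) → O(D_p) is a ℂ-derivation of O(D_p), and the ℂ-linear map O(D_p) → Der_ℂ(O(D_p)), f ↦ ν_f, has kernel exactly the constants ℂ·1 and image exactly Ve⁰(D_p); hence it induces a ℂ-linear isomorphism O(D_p)/ℂ ≅ Ve⁰(D_p). -/

import Mathlib

open Polynomial

set_option synthInstance.maxHeartbeats 400000
set_option maxHeartbeats 800000

noncomputable section

/-- The polynomial ring `ℂ[x,y,z]` (variables indexed by `Fin 3`). -/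
abbrev P3 : Type := MvPolynomial (Fin 3) ℂ

/-- The variable `x`. -/
def xP : P3 := MvPolynomial.X 0
/-- The variable `y`. -/
def yP : P3 := MvPolynomial.X 1
/-- The variable `z`. -/
def zP : P3 := MvPolynomial.X 2

/-- The ideal `(xy - p(z)) ⊆ ℂ[x,y,z]`. -/
def relIdeal (p : ℂ[X]) : Ideal P3 := Ideal.span {xP * yP - Polynomial.aeval zP p}

/-- The coordinate ring `O(D_p) = ℂ[x,y,z]/(xy - p(z))` of the Danielewski surface `D_p`. -/
abbrev ODan (p : ℂ[X]) : Type := P3 ⧸ relIdeal p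

open MvPolynomial in
/-- The Poisson-type bracket
`{f,g} = p'(z)(f_y g_x - f_x g_y) + x(f_z g_x - f_x g_z) - y(f_z g_y - f_y g_z)`
on `ℂ[x,y,z]`. -/
def pb (p : ℂ[X]) (f g : P3) : P3 :=
  Polynomial.aeval zP (Polynomial.derivative p) *
      (pderiv (1 : Fin 3) f * pderiv (0 : Fin 3) g - pderiv (0 : Fin 3) f * pderiv (1 : Fin 3) g)
    + xP * (pderiv (2 : Fin 3) f * pderiv (0 : Fin 3) g -
        pderiv (0 : Fin 3) f * pderiv (2 : Fin 3) g)
    - yP * (pderiv (2 : Fin 3) f * pderiv (1 : Fin 3) g -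
        pderiv (1 : Fin 3) f * pderiv (2 : Fin 3) g)

/-- `Ve⁰(D_p)`: the divergence-zero vector fields on `D_p`, i.e. those derivations of
`O(D_p)` admitting a lift `δ' = ã∂/∂x + b̃∂/∂y + c̃∂/∂z ∈ Der_ℂ(ℂ[x,y,z])` with
`δ'(xy - p(z)) = 0` and `∂ã/∂x + ∂b̃/∂y + ∂c̃/∂z ∈ (xy - p(z))`. -/
def VeZero (p : ℂ[X]) : Set (Derivation ℂ (ODan p) (ODan p)) :=
  {δ | ∃ δ' : Derivation ℂ P3 P3,
    δ' (xP * yP - Polynomial.aeval zP p) = 0 ∧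
    (∀ f : P3, δ (Ideal.Quotient.mk (relIdeal p) f) = Ideal.Quotient.mk (relIdeal p) (δ' f)) ∧
    MvPolynomial.pderiv (0 : Fin 3) (δ' xP) + MvPolynomial.pderiv (1 : Fin 3) (δ' yP) +
      MvPolynomial.pderiv (2 : Fin 3) (δ' zP) ∈ relIdeal p}

namespace Dan
open MvPolynomial

def wt (m : Fin 3 →₀ ℕ) : ℤ := (m 0 : ℤ) - (m 1 : ℤ)

def diag (u : ℤ → ℂ) : P3 →ₗ[ℂ] P3 :=
  (MvPolynomial.basisMonomials (Fin 3) ℂ).constr ℂ (fun m => u (wt m) • monomial m (1 : ℂ))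

lemma diag_mon (u : ℤ → ℂ) (m : Fin 3 →₀ ℕ) (c : ℂ) :
    diag u (monomial m c) = u (wt m) • monomial m c := by
  have h : diag u (monomial m (1 : ℂ)) = u (wt m) • monomial m (1 : ℂ) := by
    have := (MvPolynomial.basisMonomials (Fin 3) ℂ).constr_basis ℂ
      (fun m => u (wt m) • (monomial m (1 : ℂ) : P3)) m
    rwa [MvPolynomial.coe_basisMonomials] at this
  have h2 : (monomial m c : P3) = c • monomial m (1 : ℂ) := by
    simp [MvPolynomial.smul_monomial]
  rw [h2, map_smul, h, smul_comm]

lemma lin_ext (L M : P3 →ₗ[ℂ] P3) (h : ∀ m c, L (monomial m c) = M (monomial m c)) (f : P3) :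
    L f = M f := by
  induction f using MvPolynomial.induction_on' with
  | monomial m c => exact h m c
  | add a b ha hb => rw [map_add, map_add, ha, hb]

lemma diag_diag (u v : ℤ → ℂ) (f : P3) : diag u (diag v f) = diag (fun n => u n * v n) f := by
  refine lin_ext ((diag u).comp (diag v)) _ (fun m c => ?_) f
  simp only [LinearMap.comp_apply, diag_mon, map_smul, smul_smul]
  rw [mul_comm]

lemma diag_mon_mul (u : ℤ → ℂ) (m : Fin 3 →₀ ℕ) (hm : wt m = 0) (f : P3) :
    diag u (monomial m 1 * f) = monomial m 1 * diag u f := by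
  refine lin_ext ((diag u).comp (LinearMap.mulLeft ℂ (monomial m 1)))
    ((LinearMap.mulLeft ℂ (monomial m 1)).comp (diag u)) (fun m' c => ?_) f
  simp only [LinearMap.comp_apply, diag_mon, map_smul, LinearMap.mulLeft_apply, monomial_mul]
  have : wt (m + m') = wt m' := by
    simp only [wt, Finsupp.add_apply] at *
    push_cast
    omega
  rw [this]

lemma diag_xy (u : ℤ → ℂ) (f : P3) : diag u (xP * yP * f) = xP * yP * diag u f := by
  have : (xP * yP : P3) = MvPolynomial.monomial
      ((Finsupp.single 0 1 + Finsupp.single 1 1 : Fin 3 →₀ ℕ)) (1 : ℂ) := by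
    simp [xP, yP, MvPolynomial.X, MvPolynomial.monomial_mul]
  rw [this]
  exact diag_mon_mul u _ (by simp [wt]) f

lemma diag_z (u : ℤ → ℂ) (f : P3) : diag u (zP * f) = zP * diag u f :=
  diag_mon_mul u (Finsupp.single 2 1) (by simp [wt]) f

lemma diag_aeval (u : ℤ → ℂ) (q : ℂ[X]) (f : P3) :
    diag u (Polynomial.aeval zP q * f) = Polynomial.aeval zP q * diag u f := by
  induction q using Polynomial.induction_on' with
  | add a b ha hb => simp only [map_add, add_mul, ha, hb]
  | monomial n a =>
    rw [Polynomial.aeval_monomial, ← Algebra.smul_def, smul_mul_assoc, smul_mul_assoc, map_smul]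
    congr 1
    induction n with
    | zero => simp
    | succ n ih => rw [pow_succ', mul_assoc, diag_z, ih, mul_assoc]

def Frel (p : ℂ[X]) : P3 := xP * yP - Polynomial.aeval zP p

lemma diag_F (u : ℤ → ℂ) (p : ℂ[X]) (f : P3) : diag u (Frel p * f) = Frel p * diag u f := by
  simp only [Frel, sub_mul, map_sub, diag_xy, diag_aeval]

lemma mem_rel (p : ℂ[X]) (f : P3) : f ∈ relIdeal p ↔ ∃ h, f = Frel p * h := by
  rw [relIdeal, Ideal.mem_span_singleton]; rfl

def proj0 : P3 →ₗ[ℂ] P3 := diag (fun n => if n = 0 then 1 else 0)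
def Einv : P3 →ₗ[ℂ] P3 := diag (fun n => (n : ℂ)⁻¹)
def Eop (f : P3) : P3 := xP * pderiv 0 f - yP * pderiv 1 f

lemma Eop_eq (f : P3) : Eop f = diag (fun n => (n : ℂ)) f := by
  refine lin_ext ((LinearMap.mulLeft ℂ xP).comp (pderiv 0 : Derivation ℂ P3 P3).toLinearMap -
    (LinearMap.mulLeft ℂ yP).comp (pderiv 1 : Derivation ℂ P3 P3).toLinearMap) _ (fun m c => ?_) f
  simp only [LinearMap.sub_apply, LinearMap.comp_apply, LinearMap.mulLeft_apply, diag_mon]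
  change xP * pderiv 0 (monomial m c) - yP * pderiv 1 (monomial m c) = _
  rw [xP, yP, X_mul_pderiv_monomial, X_mul_pderiv_monomial, wt]
  push_cast
  rw [sub_smul, Nat.cast_smul_eq_nsmul, Nat.cast_smul_eq_nsmul]

lemma diag_congr {u v : ℤ → ℂ} (h : ∀ n, u n = v n) (f : P3) : diag u f = diag v f := by
  rw [funext h]

lemma diag_one_sub (f : P3) : diag (fun n => if n = 0 then 0 else 1) f = f - proj0 f := by
  refine lin_ext _ (LinearMap.id - proj0) (fun m c => ?_) f
  simp only [proj0, LinearMap.sub_apply, diag_mon, LinearMap.id_apply]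
  split_ifs <;> simp

lemma Einv_E (f : P3) : Einv (Eop f) = f - proj0 f := by
  rw [Eop_eq, Einv, diag_diag, ← diag_one_sub]
  refine diag_congr (fun n => ?_) f
  split_ifs with h
  · simp [h]
  · have : (n : ℂ) ≠ 0 := by exact_mod_cast h
    field_simp

lemma E_Einv (f : P3) : Eop (Einv f) = f - proj0 f := by
  rw [← Einv_E, Eop_eq, Eop_eq, Einv, diag_diag, diag_diag]
  exact diag_congr (fun n => mul_comm _ _) f

lemma diag_zero (f : P3) : diag (fun _ => 0) f = 0 := by
  refine lin_ext _ 0 (fun m c => ?_) f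
  simp [diag_mon]

lemma proj0_E (f : P3) : proj0 (Eop f) = 0 := by
  rw [Eop_eq, proj0, diag_diag, ← diag_zero f]
  refine diag_congr (fun n => ?_) f
  split_ifs with h <;> simp [h]

lemma E_proj0 (f : P3) : Eop (proj0 f) = 0 := by
  rw [← proj0_E f, Eop_eq, Eop_eq, proj0, diag_diag, diag_diag]
  exact diag_congr (fun n => mul_comm _ _) f

lemma proj0_of_E {f : P3} (h : Eop f = 0) : proj0 f = f := by
  have := Einv_E f
  rw [h, map_zero] at this
  exact (sub_eq_zero.mp this.symm).symm

lemma Einv_of_E {f : P3} (h : Eop f = 0) : Einv f = 0 := by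
  rw [← proj0_of_E h, proj0, Einv, diag_diag, ← diag_zero f]
  refine diag_congr (fun n => ?_) f
  split_ifs with h <;> simp [h]

/-- the evaluation `x ↦ 1, y ↦ p, z ↦ z`. -/
def ev (p : ℂ[X]) : P3 →ₐ[ℂ] ℂ[X] := aeval ![1, p, Polynomial.X]

@[simp] lemma ev_x (p : ℂ[X]) : ev p xP = 1 := by simp [ev, xP]
@[simp] lemma ev_y (p : ℂ[X]) : ev p yP = p := by simp [ev, yP]
@[simp] lemma ev_z (p : ℂ[X]) : ev p zP = Polynomial.X := by simp [ev, zP]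
@[simp] lemma ev_aeval (p q : ℂ[X]) : ev p (Polynomial.aeval zP q) = q := by
  rw [← Polynomial.aeval_algHom_apply, ev_z, Polynomial.aeval_X_left_apply]
lemma ev_F (p : ℂ[X]) : ev p (Frel p) = 0 := by simp [Frel]
lemma ev_mem {p : ℂ[X]} {f : P3} (h : f ∈ relIdeal p) : ev p f = 0 := by
  obtain ⟨h, rfl⟩ := (mem_rel p f).1 h
  rw [map_mul, ev_F, zero_mul]

lemma ev_chain (p : ℂ[X]) (f : P3) : Polynomial.derivative (ev p f) =
    ev p (pderiv 1 f) * Polynomial.derivative p + ev p (pderiv 2 f) := by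
  induction f using MvPolynomial.induction_on with
  | C a => simp [ev]
  | add a b ha hb => simp only [map_add, ha, hb]; ring
  | mul_X f i h =>
    simp only [map_mul, Polynomial.derivative_mul, h, Derivation.leibniz, map_add, smul_eq_mul]
    fin_cases i <;> simp [ev, pderiv_X] <;> ring

lemma mon_split (m : Fin 3 →₀ ℕ) : (monomial m (1:ℂ) : P3) = xP ^ m 0 * yP ^ m 1 * zP ^ m 2 := by
  rw [monomial_eq]
  simp [Finsupp.prod_fintype, Fin.prod_univ_three, xP, yP, zP]

lemma F_mem (p : ℂ[X]) : Frel p ∈ relIdeal p := Ideal.subset_span rfl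

lemma norm_form0 (p : ℂ[X]) (f : P3) :
    ∃ q : ℂ[X], proj0 f - Polynomial.aeval zP q ∈ relIdeal p := by
  induction f using MvPolynomial.induction_on' with
  | add a b ha hb =>
    obtain ⟨q, hq⟩ := ha
    obtain ⟨r, hr⟩ := hb
    refine ⟨q + r, ?_⟩
    convert add_mem hq hr using 1
    simp only [map_add]; ring
  | monomial m c =>
    rw [proj0, diag_mon]
    split_ifs with h
    · have h01 : m 1 = m 0 := by simp only [wt] at h; omega
      refine ⟨Polynomial.C c * (p ^ m 0 * Polynomial.X ^ m 2), ?_⟩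
      have h2 : (monomial m c : P3) = c • monomial m (1 : ℂ) := by simp [MvPolynomial.smul_monomial]
      rw [one_smul, h2, mon_split, h01, ← mul_pow, ← Polynomial.smul_eq_C_mul, map_smul, ← smul_sub]
      refine Submodule.smul_of_tower_mem _ _ ?_
      simp only [map_mul, map_pow, Polynomial.aeval_X]
      rw [← sub_mul]
      refine Ideal.mul_mem_right _ _ ?_
      exact Ideal.mem_of_dvd _ (sub_dvd_pow_sub_pow _ _ _) (F_mem p)
    · exact ⟨0, by simp⟩

lemma norm_form (p : ℂ[X]) (f : P3) :
    proj0 f - Polynomial.aeval zP (ev p (proj0 f)) ∈ relIdeal p := by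
  obtain ⟨q, hq⟩ := norm_form0 p f
  have := ev_mem hq
  rw [map_sub, ev_aeval, sub_eq_zero] at this
  rwa [this]

lemma xy_form (f : P3) :
    ∃ (C : P3) (q : ℂ[X]), proj0 f = xP * yP * proj0 C + Polynomial.aeval zP q := by
  induction f using MvPolynomial.induction_on' with
  | add a b ha hb =>
    obtain ⟨C, q, hq⟩ := ha
    obtain ⟨D, r, hr⟩ := hb
    refine ⟨C + D, q + r, ?_⟩
    simp only [map_add, hq, hr]; ring
  | monomial m c =>
    by_cases h : wt m = 0
    · have h01 : m 1 = m 0 := by simp only [wt] at h; omega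
      have h2 : (monomial m c : P3) = c • monomial m (1 : ℂ) := by simp [MvPolynomial.smul_monomial]
      have h3 : proj0 (monomial m c) = monomial m c := by
        rw [proj0, diag_mon, if_pos h, one_smul]
      rcases Nat.eq_zero_or_pos (m 0) with h0 | h0
      · refine ⟨0, c • Polynomial.X ^ m 2, ?_⟩
        rw [h3, h2, mon_split, h01, h0]
        simp
      · obtain ⟨k, hk⟩ : ∃ k, m 0 = k + 1 := ⟨m 0 - 1, by omega⟩
        refine ⟨c • (xP ^ k * yP ^ k * zP ^ m 2), 0, ?_⟩
        rw [proj0, ← diag_xy, ← proj0, ← h3, proj0_of_E (E_proj0 _), h3, h2, mon_split, h01, hk, map_zero,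
          add_zero, mul_smul_comm]
        have h4 : (xP * yP * (xP ^ k * yP ^ k * zP ^ m 2) : P3) = monomial m 1 := by
          rw [mon_split, h01, hk]; ring
        rw [h4, map_smul, proj0, diag_mon, if_pos h, one_smul, mon_split, h01, hk]
    · refine ⟨0, 0, ?_⟩
      rw [proj0, diag_mon, if_neg h]; simp

@[simp] lemma d_x0 : pderiv (0 : Fin 3) xP = 1 := by simp [xP, pderiv_X]
@[simp] lemma d_x1 : pderiv (1 : Fin 3) xP = 0 := by simp [xP, pderiv_X]
@[simp] lemma d_x2 : pderiv (2 : Fin 3) xP = 0 := by simp [xP, pderiv_X]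
@[simp] lemma d_y0 : pderiv (0 : Fin 3) yP = 0 := by simp [yP, pderiv_X]
@[simp] lemma d_y1 : pderiv (1 : Fin 3) yP = 1 := by simp [yP, pderiv_X]
@[simp] lemma d_y2 : pderiv (2 : Fin 3) yP = 0 := by simp [yP, pderiv_X]
@[simp] lemma d_z0 : pderiv (0 : Fin 3) zP = 0 := by simp [zP, pderiv_X]
@[simp] lemma d_z1 : pderiv (1 : Fin 3) zP = 0 := by simp [zP, pderiv_X]
@[simp] lemma d_z2 : pderiv (2 : Fin 3) zP = 1 := by simp [zP, pderiv_X]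

lemma d_aeval (D : Derivation ℂ P3 P3) (q : ℂ[X]) : D (Polynomial.aeval zP q) =
    Polynomial.aeval zP (Polynomial.derivative q) * D zP := by
  induction q using Polynomial.induction_on' with
  | add a b ha hb => simp only [map_add, ha, hb]; ring
  | monomial n a =>
    simp [Polynomial.aeval_monomial, Polynomial.derivative_monomial, Derivation.leibniz_pow]
    ring

@[simp] lemma d_q0 (q : ℂ[X]) : pderiv (0 : Fin 3) (Polynomial.aeval zP q) = 0 := by
  rw [d_aeval]; simp
@[simp] lemma d_q1 (q : ℂ[X]) : pderiv (1 : Fin 3) (Polynomial.aeval zP q) = 0 := by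
  rw [d_aeval]; simp
@[simp] lemma d_q2 (q : ℂ[X]) : pderiv (2 : Fin 3) (Polynomial.aeval zP q) =
    Polynomial.aeval zP (Polynomial.derivative q) := by
  rw [d_aeval]; simp

lemma d_comm (i j : Fin 3) (f : P3) : pderiv i (pderiv j f) = pderiv j (pderiv i f) := by
  have h : ⁅(pderiv i : Derivation ℂ P3 P3), (pderiv j : Derivation ℂ P3 P3)⁆ = 0 := by
    apply MvPolynomial.derivation_ext
    intro k
    simp [Derivation.commutator_apply, pderiv_X, Pi.single_apply]
    split_ifs <;> simp
  have h2 := congrArg (fun D => D f) h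
  simpa [Derivation.commutator_apply, sub_eq_zero] using h2

/-- `{f, ·}` as a derivation of the polynomial ring. -/
def nu (p : ℂ[X]) (f : P3) : Derivation ℂ P3 P3 :=
  (Polynomial.aeval zP (Polynomial.derivative p) * pderiv 1 f + xP * pderiv 2 f) • pderiv 0
  - (Polynomial.aeval zP (Polynomial.derivative p) * pderiv 0 f + yP * pderiv 2 f) • pderiv 1
  + (yP * pderiv 1 f - xP * pderiv 0 f) • pderiv 2

lemma nu_apply (p : ℂ[X]) (f g : P3) : nu p f g = pb p f g := by
  simp only [nu, pb, Derivation.add_apply, Derivation.sub_apply, Derivation.smul_apply, smul_eq_mul]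
  ring

lemma nu_F (p : ℂ[X]) (f : P3) : nu p f (xP * yP - Polynomial.aeval zP p) = 0 := by
  rw [nu_apply]
  simp [pb, Derivation.leibniz]
  ring

lemma nu_x (p : ℂ[X]) (f : P3) : nu p f xP =
    Polynomial.aeval zP (Polynomial.derivative p) * pderiv 1 f + xP * pderiv 2 f := by
  simp [nu]
lemma nu_y (p : ℂ[X]) (f : P3) : nu p f yP =
    -(Polynomial.aeval zP (Polynomial.derivative p) * pderiv 0 f + yP * pderiv 2 f) := by
  simp [nu]
lemma nu_z (p : ℂ[X]) (f : P3) : nu p f zP = - Eop f := by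
  simp [nu, Eop]

lemma nu_div (p : ℂ[X]) (f : P3) : pderiv (0 : Fin 3) (nu p f xP) + pderiv (1 : Fin 3) (nu p f yP) +
    pderiv (2 : Fin 3) (nu p f zP) = 0 := by
  rw [nu_x, nu_y, nu_z, Eop]
  simp [Derivation.leibniz]
  rw [d_comm 1 0, d_comm 2 0, d_comm 2 1]
  ring

end Dan
namespace Dan
open MvPolynomial

lemma nu_add (p : ℂ[X]) (f g : P3) : nu p (f + g) = nu p f + nu p g := by
  ext i
  simp only [nu_apply, Derivation.add_apply, pb, map_add]
  ring

lemma agree (p : ℂ[X]) (D1 D2 : Derivation ℂ P3 P3) (hx : D1 xP - D2 xP ∈ relIdeal p)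
    (hy : D1 yP - D2 yP ∈ relIdeal p) (hz : D1 zP - D2 zP ∈ relIdeal p) (g : P3) :
    D1 g - D2 g ∈ relIdeal p := by
  induction g using MvPolynomial.induction_on with
  | C a => simp
  | add a b ha hb =>
    convert add_mem ha hb using 1
    simp only [map_add]; ring
  | mul_X f i h =>
    have hi : D1 (MvPolynomial.X i) - D2 (MvPolynomial.X i) ∈ relIdeal p := by
      fin_cases i
      · exact hx
      · exact hy
      · exact hz
    convert add_mem (Ideal.mul_mem_left _ f hi) (Ideal.mul_mem_left _ (MvPolynomial.X i) h) using 1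
    simp only [Derivation.leibniz, smul_eq_mul]; ring

/-- the evaluation `x ↦ 0, y ↦ 0, z ↦ z`. -/
def ev0 : P3 →ₐ[ℂ] ℂ[X] := aeval ![0, 0, Polynomial.X]

@[simp] lemma ev0_x : ev0 xP = 0 := by simp [ev0, xP]
@[simp] lemma ev0_y : ev0 yP = 0 := by simp [ev0, yP]
@[simp] lemma ev0_z : ev0 zP = Polynomial.X := by simp [ev0, zP]
@[simp] lemma ev0_aeval (q : ℂ[X]) : ev0 (Polynomial.aeval zP q) = q := by
  rw [← Polynomial.aeval_algHom_apply, ev0_z, Polynomial.aeval_X_left_apply]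

lemma antideriv (q : ℂ[X]) : ∃ r : ℂ[X], Polynomial.derivative r = q := by
  induction q using Polynomial.induction_on' with
  | add a b ha hb =>
    obtain ⟨r, rfl⟩ := ha
    obtain ⟨s, rfl⟩ := hb
    exact ⟨r + s, by simp⟩
  | monomial n a =>
    refine ⟨Polynomial.monomial (n + 1) (a / (n + 1)), ?_⟩
    rw [Polynomial.derivative_monomial]
    have : (n : ℂ) + 1 ≠ 0 := by exact_mod_cast Nat.succ_ne_zero n
    push_cast
    rw [div_mul_cancel₀ _ this]

lemma x_ne : xP ≠ 0 := MvPolynomial.X_ne_zero _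
lemma y_ne : yP ≠ 0 := MvPolynomial.X_ne_zero _

/-- shape of vector fields tangent to the level sets, whose `z`-part has weight zero. -/
lemma shape (p : ℂ[X]) (hp : Polynomial.derivative p ≠ 0) (a b c : P3)
    (h : yP * a + xP * b = Polynomial.aeval zP (Polynomial.derivative p) * c)
    (hc : Eop c = 0) : ∃ A B C : P3, a = xP * A ∧ b = yP * B ∧ c = xP * yP * C ∧ Eop C = 0 ∧
      A + B = Polynomial.aeval zP (Polynomial.derivative p) * C := by
  obtain ⟨C, q, hq⟩ := xy_form c
  rw [proj0_of_E hc] at hq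
  have hq0 : q = 0 := by
    have h1 := congrArg ev0 h
    rw [hq] at h1
    simp only [map_add, map_mul, ev0_x, ev0_y, ev0_aeval, zero_mul, zero_add] at h1
    exact (mul_eq_zero.mp h1.symm).resolve_left hp
  rw [hq0, map_zero, add_zero] at hq
  have hdx : xP ∣ yP * a := by
    refine ⟨Polynomial.aeval zP (Polynomial.derivative p) * (yP * proj0 C) - b, ?_⟩
    linear_combination h + Polynomial.aeval zP (Polynomial.derivative p) * hq
  have hxp : Prime (xP : P3) := MvPolynomial.X_prime
  have hnd : ¬ (xP : P3) ∣ yP := by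
    rw [xP, yP, MvPolynomial.X_dvd_X]
    simp
  obtain ⟨A, hA⟩ := (hxp.dvd_or_dvd hdx).resolve_left hnd
  refine ⟨A, Polynomial.aeval zP (Polynomial.derivative p) * proj0 C - A, proj0 C, hA, ?_, hq,
    E_proj0 _, by ring⟩
  apply mul_left_cancel₀ x_ne
  linear_combination h - yP * hA + Polynomial.aeval zP (Polynomial.derivative p) * hq

lemma E_yd (C : P3) (hC : Eop C = 0) : Eop (yP * pderiv 1 C) = 0 := by
  have h := congrArg (fun g => yP * pderiv (1 : Fin 3) g) hC
  simp only [Eop, map_sub, Derivation.leibniz, smul_eq_mul, d_x1, d_y1, d_y0, map_zero, mul_zero,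
    add_zero, mul_one, map_zero] at h ⊢
  rw [d_comm 0 1]
  linear_combination h

lemma E_xyd (C : P3) (hC : Eop C = 0) : Eop (xP * yP * pderiv 2 C) = 0 := by
  have h := congrArg (fun g => xP * yP * pderiv (2 : Fin 3) g) hC
  simp only [Eop, map_sub, Derivation.leibniz, smul_eq_mul, d_x1, d_y1, d_y0, d_x0, d_x2, d_y2,
    map_zero, mul_zero, add_zero, mul_one, map_zero] at h ⊢
  rw [d_comm 0 2, d_comm 1 2]
  linear_combination h

lemma E_q (q : ℂ[X]) (C : P3) (hC : Eop C = 0) : Eop (Polynomial.aeval zP q * C) = 0 := by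
  rw [Eop_eq, diag_aeval, ← Eop_eq, hC, mul_zero]

lemma E_add (f g : P3) : Eop (f + g) = Eop f + Eop g := by
  simp only [Eop_eq, map_add]

lemma key0 (p : ℂ[X]) (hp2 : 2 ≤ p.natDegree) (D : Derivation ℂ P3 P3)
    (hF : D (xP * yP - Polynomial.aeval zP p) = 0)
    (hdiv : pderiv (0 : Fin 3) (D xP) + pderiv (1 : Fin 3) (D yP) + pderiv (2 : Fin 3) (D zP)
      ∈ relIdeal p) (hz : Eop (D zP) = 0) :
    ∃ f, ∀ g, D g - nu p f g ∈ relIdeal p := by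
  have hp' : Polynomial.derivative p ≠ 0 := by
    intro h
    have := Polynomial.natDegree_eq_zero_of_derivative_eq_zero h
    omega
  obtain ⟨A, B, C, hA, hB, hC, hEC, hAB⟩ := shape p hp' (D xP) (D yP) (D zP) (by
    rw [map_sub, d_aeval, Derivation.leibniz, smul_eq_mul, smul_eq_mul] at hF
    linear_combination hF) hz
  set G : P3 := Polynomial.aeval zP (Polynomial.derivative p) * C +
    Polynomial.aeval zP (Polynomial.derivative p) * (yP * pderiv 1 C) + xP * yP * pderiv 2 C with hG
  have hEG : Eop G = 0 := by
    rw [hG, E_add, E_add, E_q _ _ hEC, E_q _ _ (E_yd _ hEC), E_xyd _ hEC]; simp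
  have hdiv2 : Eop A + G ∈ relIdeal p := by
    have hB' : B = Polynomial.aeval zP (Polynomial.derivative p) * C - A := by
      linear_combination hAB
    rw [hA, hB, hC, hB'] at hdiv
    convert hdiv using 1
    simp only [hG, Eop, map_sub, Derivation.leibniz, smul_eq_mul, d_x1, d_y1, d_y0, d_x0, d_x2, d_y2,
      d_q1]
    ring
  obtain ⟨h, hh⟩ := (mem_rel p _).1 hdiv2
  have hG0 : G ∈ relIdeal p := by
    have := congrArg proj0 hh
    rw [map_add, proj0_E, zero_add, proj0_of_E hEG, proj0, diag_F] at this
    exact (mem_rel p _).2 ⟨_, this⟩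
  have hA0 : A - proj0 A ∈ relIdeal p := by
    have := congrArg Einv hh
    rw [map_add, Einv_E, Einv_of_E hEG, add_zero, Einv, diag_F] at this
    exact (mem_rel p _).2 ⟨_, this⟩
  have hCm : C ∈ relIdeal p := by
    have h1 := ev_mem hG0
    have h2 : Polynomial.derivative (p * ev p C) = 0 := by
      rw [Polynomial.derivative_mul, ev_chain]
      rw [hG] at h1
      simp only [map_add, map_mul, ev_aeval, ev_x, ev_y] at h1
      linear_combination h1
    have h3 := Polynomial.natDegree_eq_zero_of_derivative_eq_zero h2
    have h4 : ev p C = 0 := by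
      by_contra hne
      have hp0 : p ≠ 0 := by rintro rfl; simp at hp2
      rw [Polynomial.natDegree_mul hp0 hne] at h3
      omega
    have h5 := norm_form p C
    rw [proj0_of_E hEC, h4] at h5
    simpa using h5
  have hA1 : A - Polynomial.aeval zP (ev p (proj0 A)) ∈ relIdeal p := by
    convert add_mem hA0 (norm_form p A) using 1
    ring
  obtain ⟨r, hr⟩ := antideriv (ev p (proj0 A))
  rw [← hr] at hA1
  refine ⟨Polynomial.aeval zP r, agree p _ _ ?_ ?_ ?_⟩
  · rw [nu_x, hA, d_q1, d_q2]
    convert Ideal.mul_mem_left _ xP hA1 using 1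
    ring
  · rw [nu_y, hB, d_q0, d_q2]
    convert Ideal.mul_mem_left _ yP (sub_mem (Ideal.mul_mem_left _
      (Polynomial.aeval zP (Polynomial.derivative p)) hCm) hA1) using 1
    linear_combination yP * hAB
  · rw [nu_z, hC, Eop, d_q1, d_q0]
    convert Ideal.mul_mem_left _ (xP * yP) hCm using 1
    ring

lemma key (p : ℂ[X]) (hp2 : 2 ≤ p.natDegree) (D : Derivation ℂ P3 P3)
    (hF : D (xP * yP - Polynomial.aeval zP p) = 0)
    (hdiv : pderiv (0 : Fin 3) (D xP) + pderiv (1 : Fin 3) (D yP) + pderiv (2 : Fin 3) (D zP)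
      ∈ relIdeal p) :
    ∃ f, ∀ g, D g - nu p f g ∈ relIdeal p := by
  obtain ⟨f, hf⟩ := key0 p hp2 (D + nu p (Einv (D zP)))
    (by rw [Derivation.add_apply, hF, nu_F, add_zero])
    (by
      convert hdiv using 1
      have := nu_div p (Einv (D zP))
      simp only [Derivation.add_apply, map_add]
      linear_combination this)
    (by
      rw [Derivation.add_apply, nu_z, E_Einv, neg_sub, add_sub_cancel, E_proj0])
  refine ⟨f - Einv (D zP), fun g => ?_⟩
  convert hf g using 1
  have h2 : nu p f = nu p (f - Einv (D zP)) + nu p (Einv (D zP)) := by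
    rw [← nu_add, sub_add_cancel]
  rw [h2, Derivation.add_apply, Derivation.add_apply]
  ring

lemma kern (p : ℂ[X]) (f : P3) (h : ∀ g, pb p f g ∈ relIdeal p) :
    ∃ c : ℂ, f - algebraMap ℂ P3 c ∈ relIdeal p := by
  have hz := h zP
  rw [← nu_apply, nu_z, neg_mem_iff] at hz
  obtain ⟨k, hk⟩ := (mem_rel p _).1 hz
  have h1 : f - proj0 f ∈ relIdeal p := by
    have := congrArg Einv hk
    rw [Einv_E, Einv, diag_F] at this
    exact (mem_rel p _).2 ⟨_, this⟩
  obtain ⟨q, hq⟩ := norm_form0 p f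
  have h2 : f - Polynomial.aeval zP q ∈ relIdeal p := by
    convert add_mem h1 hq using 1
    ring
  obtain ⟨s, hs⟩ := (mem_rel p _).1 h2
  have h3 : pb p (Frel p * s) xP ∈ relIdeal p := by
    have e : pb p (Frel p * s) xP = Frel p * pb p s xP := by
      simp [pb, Frel, Derivation.leibniz]
      ring
    rw [e]
    exact Ideal.mul_mem_right _ _ (F_mem p)
  have h4 : pb p (Polynomial.aeval zP q) xP ∈ relIdeal p := by
    have e : pb p (Polynomial.aeval zP q) xP = pb p f xP - pb p (Frel p * s) xP := by
      rw [← hs]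
      simp only [pb, map_sub]
      ring
    rw [e]
    exact sub_mem (h xP) h3
  have h5 := ev_mem h4
  rw [← nu_apply, nu_x, d_q1, d_q2] at h5
  simp only [mul_zero, zero_add, map_mul, ev_x, one_mul, ev_aeval] at h5
  have h6 := Polynomial.eq_C_of_derivative_eq_zero h5
  refine ⟨q.coeff 0, ?_⟩
  rw [h6, Polynomial.aeval_C] at h2
  exact h2

end Dan

/-- Let `p` be squarefree of degree at least `2` and let `{·,·}` denote the induced
bracket on `O(D_p)`.  For every `f`, the map `ν_f = {f,·}` is a `ℂ`-derivation of
`O(D_p)`; the `ℂ`-linear map `f ↦ ν_f` has kernel exactly the constants `ℂ·1` and image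
exactly `Ve⁰(D_p)`; hence it induces a `ℂ`-linear isomorphism `O(D_p)/ℂ ≅ Ve⁰(D_p)`. -/
theorem bracket_gives_divergence_zero (p : ℂ[X])
    (hsp : Squarefree p) (hp2 : 2 ≤ p.natDegree)
    (B : ODan p →ₗ[ℂ] ODan p →ₗ[ℂ] ODan p)
    (hB : ∀ f g : P3, B (Ideal.Quotient.mk (relIdeal p) f) (Ideal.Quotient.mk (relIdeal p) g) =
      Ideal.Quotient.mk (relIdeal p) (pb p f g)) :
    (∀ f : ODan p, ∃ δ : Derivation ℂ (ODan p) (ODan p), ∀ g : ODan p, δ g = B f g) ∧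
    (∀ f : ODan p, (∀ g : ODan p, B f g = 0) ↔ ∃ c : ℂ, f = algebraMap ℂ (ODan p) c) ∧
    (∀ δ : Derivation ℂ (ODan p) (ODan p),
      δ ∈ VeZero p ↔ ∃ f : ODan p, ∀ g : ODan p, δ g = B f g) := by
  have hsurj : Function.Surjective (Ideal.Quotient.mk (relIdeal p)) := Ideal.Quotient.mk_surjective
  refine ⟨?_, ?_, ?_⟩
  · intro f
    obtain ⟨f, rfl⟩ := hsurj f
    refine ⟨Derivation.mk' (B (Ideal.Quotient.mk (relIdeal p) f)) ?_, fun g => rfl⟩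
    intro a b
    obtain ⟨a, rfl⟩ := hsurj a
    obtain ⟨b, rfl⟩ := hsurj b
    rw [← map_mul, hB, hB, hB, ← Dan.nu_apply, ← Dan.nu_apply, ← Dan.nu_apply, Derivation.leibniz]
    simp only [smul_eq_mul, map_add, map_mul]
  · intro f
    obtain ⟨f, rfl⟩ := hsurj f
    constructor
    · intro h
      obtain ⟨c, hc⟩ := Dan.kern p f (fun g => by
        have := h (Ideal.Quotient.mk (relIdeal p) g)
        rwa [hB, Ideal.Quotient.eq_zero_iff_mem] at this)
      exact ⟨c, Ideal.Quotient.eq.2 hc⟩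
    · rintro ⟨c, hc⟩ g
      obtain ⟨g, rfl⟩ := hsurj g
      have hc2 : algebraMap ℂ (ODan p) c = Ideal.Quotient.mk (relIdeal p) (MvPolynomial.C c) := rfl
      rw [hc, hc2, hB]
      simp [pb]
  · intro δ
    constructor
    · rintro ⟨D, hF, hl, hdiv⟩
      obtain ⟨f, hf⟩ := Dan.key p hp2 D hF hdiv
      refine ⟨Ideal.Quotient.mk (relIdeal p) f, fun g => ?_⟩
      obtain ⟨g, rfl⟩ := hsurj g
      rw [hl, hB, ← Dan.nu_apply]
      exact Ideal.Quotient.eq.2 (hf g)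
    · rintro ⟨f, hf⟩
      obtain ⟨f, rfl⟩ := hsurj f
      refine ⟨Dan.nu p f, Dan.nu_F p f, fun g => ?_, ?_⟩
      · rw [hf, hB, Dan.nu_apply]
      · rw [Dan.nu_div]
        exact zero_mem _

end
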